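/- Let A be an oPG, i an entrance of A, and q a query on A. Then the following are equivalent: (1) q is minimal with respect to the query order among the queries q' such that the node i is winning in the parity game L(A, i, q') (i.e., i is winning in L(A, i, q) and no query q' with q' ⪯ q and q' ≠ q makes i winning in L(A, i, q')); (2) the dual A(q) is Pareto-optimal, i.e., A(q) ∈ Pr(A, i). -/

import Mathlib

open scoped Classical

/-! ## Priorities and the sub-priority order -/

/-- The sub-priority order `⪯_P` on natural-number priorities:
`m1 ⪯_P m2` iff (both odd and `m2 ≤ m1`) or (`m1` odd and `m2` even)
or (both even and `m1 ≤ m2`). -/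
def SubPrio (m1 m2 : ℕ) : Prop :=
  (Odd m1 ∧ Odd m2 ∧ m2 ≤ m1) ∨ (Odd m1 ∧ Even m2) ∨ (Even m1 ∧ Even m2 ∧ m1 ≤ m2)

/-- The dual `m†` of a priority. -/
def dualP (m : ℕ) : ℕ := if m % 2 = 1 then m + 1 else if m = 0 then 0 else m - 1

/-! ## (Open) parity games -/

/-- A raw parity game over the node type `V`: node ownership (`eve v = true`
means `v` is owned by Player ∃), the edge relation, and the priority labelling. -/
structure PreGame (V : Type) where
  eve : V → Bool
  E : V → V → Prop
  Ω : V → V → ℕ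

/-- A raw open parity game: a parity game together with lists of rightward and
leftward entrances and exits. -/
structure PreOPG (V : Type) extends PreGame V where
  Iright : List V
  Ileft : List V
  Oright : List V
  Oleft : List V

variable {V W : Type}

/-- The entrances of an open parity game. -/
def PreOPG.ent (A : PreOPG V) : List V := A.Iright ++ A.Ileft

/-- The exits of an open parity game. -/
def PreOPG.exits (A : PreOPG V) : List V := A.Oright ++ A.Oleft

/-- Well-formedness of an open parity game (with maximal priority `M`). -/
structure OPGwf (M : ℕ) (A : PreOPG V) : Prop where
  nonempty : Nonempty V
  finite : Finite V
  succ : ∀ v, ∃ v', A.E v v'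
  prio_le : ∀ v v', A.E v v' → A.Ω v v' ≤ M
  ends_eve : ∀ v ∈ A.ent ++ A.exits, A.eve v = true
  ends_nodup : (A.ent ++ A.exits).Nodup
  exit_sink : ∀ o ∈ A.exits, ∀ v, A.E o v → v = o
  exit_self : ∀ o ∈ A.exits, A.E o o ∧ A.Ω o o = 0

/-! ## Strategies and plays -/

/-- An ∃-strategy: given the strict history and the current node (together a
finite path ending in the current node), pick a successor; it must follow
edges at nodes owned by Player ∃. -/
def IsEStrat (G : PreGame V) (σ : List V → V → V) : Prop :=
  ∀ h v, G.eve v = true → G.E v (σ h v)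

/-- A ∀-strategy. -/
def IsAStrat (G : PreGame V) (σ : List V → V → V) : Prop :=
  ∀ h v, G.eve v = false → G.E v (σ h v)

/-- A strategy is positional if it only depends on the last node of the path. -/
def Positional (σ : List V → V → V) : Prop := ∀ h h' v, σ h v = σ h' v

/-- The pair (strict history, current node) after `n` steps of the play
from `v` induced by the strategies `σe, σa`. -/
def playPath (G : PreGame V) (σe σa : List V → V → V) (v : V) : ℕ → List V × V
  | 0 => ([], v)
  | n + 1 =>
      let hc := playPath G σe σa v n
      (hc.1 ++ [hc.2], if G.eve hc.2 then σe hc.1 hc.2 else σa hc.1 hc.2)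

/-- The play from `v` induced by the strategies `σe, σa`. -/
def playSeq (G : PreGame V) (σe σa : List V → V → V) (v : V) (n : ℕ) : V :=
  (playPath G σe σa v n).2

/-- The parity condition: the maximum priority occurring infinitely often
along the play is even. -/
def PlayWins (G : PreGame V) (p : ℕ → V) : Prop :=
  ∃ m, Even m ∧ (∃ᶠ j in Filter.atTop, G.Ω (p j) (p (j + 1)) = m) ∧
    ∀ m', (∃ᶠ j in Filter.atTop, G.Ω (p j) (p (j + 1)) = m') → m' ≤ m

/-- A node of a parity game is winning (for Player ∃) if some ∃-strategy beats
every ∀-strategy from that node. -/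
def WinningNode (G : PreGame V) (v : V) : Prop :=
  ∃ σe, IsEStrat G σe ∧ ∀ σa, IsAStrat G σa → PlayWins G (playSeq G σe σa v)

/-! ## The domain of an open parity game and denotations -/

/-- The carrier of the domain `D(A) = {⊥, ⊤} ∪ (O × ℙ)` of an oPG. -/
inductive Dom (V : Type) where
  | bot : Dom V
  | top : Dom V
  | ex : V → ℕ → Dom V

/-- The domain order `⪯_D`. -/
def DomLE (d1 d2 : Dom V) : Prop :=
  d1 = Dom.bot ∨ d2 = Dom.top ∨
    ∃ o m1 m2, d1 = Dom.ex o m1 ∧ d2 = Dom.ex o m2 ∧ SubPrio m1 m2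

/-- Membership in the domain `D(A)` (exit points carry exits of `A` and
priorities bounded by `M`). -/
def InDom (M : ℕ) (A : PreOPG V) (d : Dom V) : Prop :=
  ∀ o m, d = Dom.ex o m → o ∈ A.exits ∧ m ≤ M

/-- Mapping domain elements along a renaming of exits. -/
def Dom.map (f : V → W) : Dom V → Dom W
  | .bot => .bot
  | .top => .top
  | .ex o m => .ex (f o) m

/-- The denotation of a play, as a relation: `PlayDen A p d` holds iff `⟦p⟧ = d`. -/
def PlayDen (A : PreOPG V) (p : ℕ → V) (d : Dom V) : Prop :=
  (∃ j, p j ∈ A.exits ∧ (∀ k, k < j → p k ∉ A.exits) ∧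
      d = Dom.ex (p j) ((Finset.range j).sup fun k => A.Ω (p k) (p (k + 1)))) ∨
  ((∀ j, p j ∉ A.exits) ∧ PlayWins A.toPreGame p ∧ d = Dom.top) ∨
  ((∀ j, p j ∉ A.exits) ∧ ¬ PlayWins A.toPreGame p ∧ d = Dom.bot)

/-- `{ ⟦play(σe, σa, i)⟧ : σa a ∀-strategy }`. -/
def denSet (A : PreOPG V) (σe : List V → V → V) (i : V) : Set (Dom V) :=
  { d | ∃ σa, IsAStrat A.toPreGame σa ∧ PlayDen A (playSeq A.toPreGame σe σa i) d }

/-- `Min(T)`: the set of `⪯_D`-minimal elements of `T`. -/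
def minSet (T : Set (Dom V)) : Set (Dom V) :=
  { d | d ∈ T ∧ ∀ d' ∈ T, DomLE d' d → d' = d }

/-- The upper preorder `⪯_U` on subsets of the domain. -/
def UpLE (T1 T2 : Set (Dom V)) : Prop := ∀ d2 ∈ T2, ∃ d1 ∈ T1, DomLE d1 d2

/-- `Max(S)`: the set of `⪯_U`-maximal elements of `S`. -/
def maxSets (S : Set (Set (Dom V))) : Set (Set (Dom V)) :=
  { T | T ∈ S ∧ ∀ T' ∈ S, UpLE T T' → UpLE T' T }

/-- The Pareto front `Pr(A, i)` of an oPG `A` at an entrance `i`. -/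
def pareto (A : PreOPG V) (i : V) : Set (Set (Dom V)) :=
  maxSets { T | ∃ σe, IsEStrat A.toPreGame σe ∧ T = minSet (denSet A σe i) }

/-- The denotation `⟦i⟧` of an entrance `i`. -/
def denEntrance (A : PreOPG V) (i : V) : Set (Set (Dom V)) :=
  { T | ∃ σe, IsEStrat A.toPreGame σe ∧ T = denSet A σe i }

/-- The entrance `i` is winning if `{⊤} ∈ ⟦i⟧`. -/
def WinningEnt (A : PreOPG V) (i : V) : Prop :=
  ({Dom.top} : Set (Dom V)) ∈ denEntrance A i

/-- The entrance `i` is losing if `⊥ ∈ T` for every `T ∈ ⟦i⟧`. -/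
def LosingEnt (A : PreOPG V) (i : V) : Prop :=
  ∀ T ∈ denEntrance A i, Dom.bot ∈ T

/-- The entrance `i` is pending if it is neither winning nor losing. -/
def PendingEnt (A : PreOPG V) (i : V) : Prop :=
  ¬ WinningEnt A i ∧ ¬ LosingEnt A i

/-- A result: a nonempty antichain in the domain `D(A)`. -/
def IsResult (M : ℕ) (A : PreOPG V) (r : Set (Dom V)) : Prop :=
  r.Nonempty ∧ minSet r = r ∧ ∀ d ∈ r, InDom M A d

/-! ## Queries, duals and the loop construction -/

/-- A query assigns to each exit a priority or `⊥` (`none`);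
well-formedness: its priority values on exits are bounded by `M`. -/
def QueryWF (M : ℕ) (A : PreOPG V) (q : V → Option ℕ) : Prop :=
  ∀ o ∈ A.exits, ∀ m, q o = some m → m ≤ M

/-- Equality of queries (as functions on the exits). -/
def QueryEq (A : PreOPG V) (q q' : V → Option ℕ) : Prop :=
  ∀ o ∈ A.exits, q o = q' o

/-- The (pointwise) query order. -/
def QueryLE (A : PreOPG V) (q q' : V → Option ℕ) : Prop :=
  ∀ o ∈ A.exits, q o = none ∨ ∃ m m', q o = some m ∧ q' o = some m' ∧ SubPrio m m'

/-- The dual `A(q)` of a query `q`. -/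
def queryDual (A : PreOPG V) (q : V → Option ℕ) : Set (Dom V) :=
  { d | ((∀ o ∈ A.exits, q o = none) ∧ d = Dom.top) ∨
        (∃ o ∈ A.exits, ∃ m, q o = some m ∧ d = Dom.ex o (dualP m)) }

/-- The loop construction `L(A, i, q)`: keep all edges not leaving an exit;
from each exit `o` with `q o = some m` add an edge to `i` with priority `m`;
from each exit `o` with `q o = none` add a self-loop with priority `1`. -/
noncomputable def loopPG (A : PreOPG V) (i : V) (q : V → Option ℕ) : PreGame V where
  eve := A.eve
  E := fun v v' =>
    (A.E v v' ∧ v ∉ A.exits) ∨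
    (v ∈ A.exits ∧ (∃ m, q v = some m) ∧ v' = i) ∨
    (v ∈ A.exits ∧ q v = none ∧ v' = v)
  Ω := fun v v' =>
    if v ∈ A.exits then (match q v with | some m => m | none => 1) else A.Ω v v'

/-! ## The shortcut construction -/

/-- The shortcut oPG `S(A)`: its nodes are the open ends of `A` (owned by
Player ∃) together with one ∀-node `(i, r)` for each entrance `i` and each
Pareto-optimal result `r ∈ Pr(A, i)`. -/
noncomputable def shortcut (A : PreOPG V) : PreOPG (V ⊕ (V × Set (Dom V))) where
  eve := fun x => match x with | .inl _ => true | .inr _ => false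
  E := fun x y => match x, y with
    | .inl v, .inr (i, r) => v = i ∧ i ∈ A.ent ∧ r ∈ pareto A i
    | .inr (i, r), .inl o => i ∈ A.ent ∧ r ∈ pareto A i ∧ ∃ m, Dom.ex o m ∈ r
    | .inl o, .inl o' => o ∈ A.exits ∧ o' = o
    | .inr (i, r), .inr (i', r') =>
        i = i' ∧ r = r' ∧ i ∈ A.ent ∧ r ∈ pareto A i ∧ (Dom.top ∈ r ∨ Dom.bot ∈ r)
  Ω := fun x y => match x, y with
    | .inl _, _ => 0
    | .inr (_, r), .inl o => sSup { m | Dom.ex o m ∈ r }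
    | .inr (_, r), .inr _ => if Dom.bot ∈ r then 1 else 0
  Iright := A.Iright.map Sum.inl
  Ileft := A.Ileft.map Sum.inl
  Oright := A.Oright.map Sum.inl
  Oleft := A.Oleft.map Sum.inl

/-! ## Sum and sequential composition -/

/-- The sum `A ⊕ B` of open parity games. -/
def sumOPG (A : PreOPG V) (B : PreOPG W) : PreOPG (V ⊕ W) where
  eve := Sum.elim A.eve B.eve
  E := fun x y => match x, y with
    | .inl v, .inl v' => A.E v v'
    | .inr w, .inr w' => B.E w w'
    | _, _ => False
  Ω := fun x y => match x, y with
    | .inl v, .inl v' => A.Ω v v'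
    | .inr w, .inr w' => B.Ω w w'
    | _, _ => 0
  Iright := A.Iright.map Sum.inl ++ B.Iright.map Sum.inr
  Ileft := A.Ileft.map Sum.inl ++ B.Ileft.map Sum.inr
  Oright := A.Oright.map Sum.inl ++ B.Oright.map Sum.inr
  Oleft := A.Oleft.map Sum.inl ++ B.Oleft.map Sum.inr

/-- The (bidirectional) sequential composition `A ⨟ B` of open parity games:
the `k`-th rightward exit of `A` is connected (with priority `0`) to the `k`-th
rightward entrance of `B`, and the `k`-th leftward exit of `B` to the `k`-th
leftward entrance of `A`. -/
def seqOPG (A : PreOPG V) (B : PreOPG W) : PreOPG (V ⊕ W) where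
  eve := Sum.elim A.eve B.eve
  E := fun x y => match x, y with
    | .inl v, .inl v' => A.E v v' ∧ v ∉ A.Oright
    | .inr w, .inr w' => B.E w w' ∧ w ∉ B.Oleft
    | .inl v, .inr w => ∃ k : ℕ, A.Oright[k]? = some v ∧ B.Iright[k]? = some w
    | .inr w, .inl v => ∃ k : ℕ, B.Oleft[k]? = some w ∧ A.Ileft[k]? = some v
  Ω := fun x y => match x, y with
    | .inl v, .inl v' => A.Ω v v'
    | .inr w, .inr w' => B.Ω w w'
    | _, _ => 0
  Iright := A.Iright.map Sum.inl
  Ileft := B.Ileft.map Sum.inr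
  Oright := B.Oright.map Sum.inr
  Oleft := A.Oleft.map Sum.inl

/-- The sequential composition `A ⨟ B` is defined when the arities match. -/
def seqDefined (A : PreOPG V) (B : PreOPG W) : Prop :=
  A.Oright.length = B.Iright.length ∧ B.Oleft.length = A.Ileft.length

/-! ## Entrance-dependent strategies on a sequential composition -/

/-- `i` is the last element of the list `p` that belongs to `I`. -/
def lastOcc {N : Type} (I : List N) (p : List N) (i : N) : Prop :=
  i ∈ I ∧ ∃ s t, p = s ++ i :: t ∧ ∀ x ∈ t, x ∉ I

/-- A positional ∃-strategy, given directly as a function on nodes. -/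
def IsPosE (G : PreGame V) (s : V → V) : Prop := ∀ v, G.eve v = true → G.E v (s v)

/-- A positional ∀-strategy, given directly as a function on nodes. -/
def IsPosA (G : PreGame V) (s : V → V) : Prop := ∀ v, G.eve v = false → G.E v (s v)

/-- Viewing a positional strategy as a history-dependent strategy. -/
def liftPos (s : V → V) : List V → V → V := fun _ v => s v

/-- All the entrances of the two components of a sequential composition. -/
def seqEnts (A : PreOPG V) (B : PreOPG W) : List (V ⊕ W) :=
  A.ent.map Sum.inl ++ B.ent.map Sum.inr

/-- `σ` is an entrance-dependent ∃-strategy on `A ⨟ B` with component families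
`σA` (over entrances of `A`) and `σB` (over entrances of `B`). -/
def EntDepE (A : PreOPG V) (B : PreOPG W)
    (σ : List (V ⊕ W) → (V ⊕ W) → (V ⊕ W))
    (σA : V → V → V) (σB : W → W → W) : Prop :=
  IsEStrat (seqOPG A B).toPreGame σ ∧
  (∀ i' ∈ A.ent, IsPosE A.toPreGame (σA i')) ∧
  (∀ i' ∈ B.ent, IsPosE B.toPreGame (σB i')) ∧
  (∀ h v, (seqOPG A B).eve v = true →
    (∀ i' x, lastOcc (seqEnts A B) (h ++ [v]) (Sum.inl i') → v = Sum.inl x →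
        σ h v = Sum.inl (σA i' x)) ∧
    (∀ i' x, lastOcc (seqEnts A B) (h ++ [v]) (Sum.inr i') → v = Sum.inr x →
        σ h v = Sum.inr (σB i' x)))

/-- `σ` is an entrance-dependent ∀-strategy on `A ⨟ B` with component families
`σA` and `σB`. -/
def EntDepA (A : PreOPG V) (B : PreOPG W)
    (σ : List (V ⊕ W) → (V ⊕ W) → (V ⊕ W))
    (σA : V → V → V) (σB : W → W → W) : Prop :=
  IsAStrat (seqOPG A B).toPreGame σ ∧
  (∀ i' ∈ A.ent, IsPosA A.toPreGame (σA i')) ∧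
  (∀ i' ∈ B.ent, IsPosA B.toPreGame (σB i')) ∧
  (∀ h v, (seqOPG A B).eve v = false →
    (∀ i' x, lastOcc (seqEnts A B) (h ++ [v]) (Sum.inl i') → v = Sum.inl x →
        σ h v = Sum.inl (σA i' x)) ∧
    (∀ i' x, lastOcc (seqEnts A B) (h ++ [v]) (Sum.inr i') → v = Sum.inr x →
        σ h v = Sum.inr (σB i' x)))

/-- `σ` is an entrance-dependent ∀-strategy (for some component families). -/
def IsEntDepA (A : PreOPG V) (B : PreOPG W)
    (σ : List (V ⊕ W) → (V ⊕ W) → (V ⊕ W)) : Prop :=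
  ∃ σA σB, EntDepA A B σ σA σB

/-! ## Plays consistent with an ∃-strategy -/

/-- `p` is a play from `v` in which Player ∃ follows `σ`. -/
def Consistent (G : PreGame V) (σ : List V → V → V) (v : V) (p : ℕ → V) : Prop :=
  p 0 = v ∧ ∀ n,
    (G.eve (p n) = true → p (n + 1) = σ ((List.range n).map p) (p n)) ∧
    (G.eve (p n) = false → G.E (p n) (p (n + 1)))

theorem playPath_fst (G : PreGame V) (σe σa : List V → V → V) (v : V) (n : ℕ) :
    (playPath G σe σa v n).1 = (List.range n).map (playSeq G σe σa v) := by
  induction n with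
  | zero => rfl
  | succ n ih => simp [playPath, List.range_succ, ih, playSeq]

theorem consistent_playSeq {G : PreGame V} {σe σa : List V → V → V} (ha : IsAStrat G σa)
    (v : V) : Consistent G σe v (playSeq G σe σa v) := by
  refine ⟨rfl, fun n => ⟨fun h => ?_, fun h => ?_⟩⟩
  · rw [← playPath_fst]
    simp only [playSeq] at h
    simp [playSeq, playPath, h]
  · have := ha (playPath G σe σa v n).1 _ h
    simp only [playSeq] at h
    simpa [playSeq, playPath, h] using this

theorem Consistent.exists_aStrat {G : PreGame V} {σ : List V → V → V} {v : V} {p : ℕ → V}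
    (succ : ∀ v, ∃ v', G.E v v') (hp : Consistent G σ v p) :
    ∃ σa, IsAStrat G σa ∧ playSeq G σ σa v = p := by
  choose s hs using succ
  let σa : List V → V → V := fun h u =>
    if G.E u (p (h.length + 1)) then p (h.length + 1) else s u
  have hpath : ∀ n, playPath G σ σa v n = ((List.range n).map p, p n) := by
    intro n
    induction n with
    | zero => simp [playPath, hp.1]
    | succ n ih =>
      simp only [playPath, ih, List.range_succ, List.map_append, List.map_cons, List.map_nil]
      cases h : G.eve (p n)
      · have := (hp.2 n).2 h
        simp [σa, this]
      · simp [(hp.2 n).1 h]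
  refine ⟨σa, fun h u _ => ?_, funext fun n => by simp [playSeq, hpath]⟩
  by_cases hE : G.E u (p (h.length + 1))
  · simp [σa, hE]
  · simpa [σa, hE] using hs u

theorem Consistent.edge {G : PreGame V} {σ : List V → V → V} {v : V} {p : ℕ → V}
    (hσ : IsEStrat G σ) (hp : Consistent G σ v p) (n : ℕ) : G.E (p n) (p (n + 1)) := by
  cases h : G.eve (p n)
  · exact (hp.2 n).2 h
  · rw [(hp.2 n).1 h]
    exact hσ _ _ h

theorem winningNode_iff {G : PreGame V} (succ : ∀ v, ∃ v', G.E v v') (v : V) :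
    WinningNode G v ↔ ∃ σ, IsEStrat G σ ∧ ∀ p, Consistent G σ v p → PlayWins G p := by
  refine exists_congr fun σ => and_congr_right fun _ => ⟨fun h p hp => ?_, fun h σa ha => ?_⟩
  · obtain ⟨σa, ha, rfl⟩ := hp.exists_aStrat succ
    exact h σa ha
  · exact h _ (consistent_playSeq ha v)

theorem mem_denSet_iff {A : PreOPG V} (succ : ∀ v, ∃ v', A.E v v') (σ : List V → V → V)
    (i : V) (d : Dom V) :
    d ∈ denSet A σ i ↔ ∃ p, Consistent A.toPreGame σ i p ∧ PlayDen A p d := by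
  constructor
  · rintro ⟨σa, ha, hd⟩
    exact ⟨_, consistent_playSeq ha i, hd⟩
  · rintro ⟨p, hp, hd⟩
    obtain ⟨σa, ha, rfl⟩ := hp.exists_aStrat succ
    exact ⟨σa, ha, hd⟩

theorem exists_playDen (A : PreOPG V) (p : ℕ → V) : ∃ d, PlayDen A p d := by
  by_cases h : ∃ j, p j ∈ A.exits
  · exact ⟨_, Or.inl ⟨Nat.find h, Nat.find_spec h, fun k hk => Nat.find_min h hk, rfl⟩⟩
  · have h' : ∀ j, p j ∉ A.exits := fun j hj => h ⟨j, hj⟩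
    by_cases hw : PlayWins A.toPreGame p
    · exact ⟨_, Or.inr (Or.inl ⟨h', hw, rfl⟩)⟩
    · exact ⟨_, Or.inr (Or.inr ⟨h', hw, rfl⟩)⟩

/-! ## Priorities occurring infinitely often -/

/-- `m` is the largest value taken infinitely often by `c`. -/
def IsLimMax (c : ℕ → ℕ) (m : ℕ) : Prop :=
  (∃ᶠ j in Filter.atTop, c j = m) ∧ ∀ m', (∃ᶠ j in Filter.atTop, c j = m') → m' ≤ m

theorem playWins_iff (G : PreGame V) (p : ℕ → V) :
    PlayWins G p ↔ ∃ m, Even m ∧ IsLimMax (fun j => G.Ω (p j) (p (j + 1))) m := Iff.rfl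

theorem exists_isLimMax {c : ℕ → ℕ} {M : ℕ} (hc : ∀ j, c j ≤ M) : ∃ m, IsLimMax c m := by
  have hex : ∃ m, ∃ᶠ j in Filter.atTop, c j = m := by
    by_contra! h
    have h' : ∀ᶠ j in Filter.atTop, ∀ m ∈ Finset.range (M + 1), c j ≠ m :=
      (Filter.eventually_all_finset _).2 fun m _ => h m
    obtain ⟨j, hj⟩ := h'.exists
    exact hj (c j) (by simpa [Nat.lt_succ_iff] using hc j) rfl
  have hb : ∀ m, (∃ᶠ j in Filter.atTop, c j = m) → m ≤ M := fun m hm => by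
    obtain ⟨j, rfl⟩ := hm.exists
    exact hc j
  obtain ⟨m₀, h₀⟩ := hex
  exact ⟨Nat.findGreatest (fun m => ∃ᶠ j in Filter.atTop, c j = m) M,
    Nat.findGreatest_spec (P := fun m => ∃ᶠ j in Filter.atTop, c j = m) (hb _ h₀) h₀,
    fun m hm => Nat.le_findGreatest (hb _ hm) hm⟩

theorem IsLimMax.eventually_le {c : ℕ → ℕ} {m M : ℕ} (hc : ∀ j, c j ≤ M)
    (h : IsLimMax c m) : ∀ᶠ j in Filter.atTop, c j ≤ m := by
  have h' : ∀ᶠ j in Filter.atTop, ∀ k ∈ Finset.Ioc m M, c j ≠ k :=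
    (Filter.eventually_all_finset _).2 fun k hk => Filter.not_frequently.1 fun hf =>
      absurd (h.2 k hf) (not_le.2 (Finset.mem_Ioc.1 hk).1)
  filter_upwards [h'] with j hj
  by_contra hlt
  exact hj (c j) (Finset.mem_Ioc.2 ⟨not_le.1 hlt, hc j⟩) rfl

theorem isLimMax_shift {c : ℕ → ℕ} {m : ℕ} (n : ℕ) :
    IsLimMax (fun j => c (n + j)) m ↔ IsLimMax c m := by
  have key : ∀ k, (∃ᶠ j in Filter.atTop, c (n + j) = k) ↔ ∃ᶠ j in Filter.atTop, c j = k := by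
    intro k
    rw [Filter.frequently_atTop, Filter.frequently_atTop]
    constructor
    · intro h a
      obtain ⟨b, hb, hcb⟩ := h a
      exact ⟨n + b, by omega, hcb⟩
    · intro h a
      obtain ⟨b, hb, hcb⟩ := h (n + a)
      exact ⟨b - n, by omega, by rwa [Nat.add_sub_cancel' (by omega)]⟩
  simp only [IsLimMax, key]

theorem isLimMax_const (k m : ℕ) : IsLimMax (fun _ => k) m ↔ m = k := by
  simp only [IsLimMax, Filter.frequently_const]
  constructor
  · exact fun h => h.1.symm
  · rintro rfl
    exact ⟨rfl, fun _ h => h.ge⟩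

/-- If `ℕ` is eventually cut into consecutive rounds starting at points of `S`, then the largest
value taken infinitely often is the maximum over one of the rounds. -/
theorem IsLimMax.of_rounds {c : ℕ → ℕ} {m M : ℕ} (hc : ∀ j, c j ≤ M) (hm : IsLimMax c m)
    {S : ℕ → Prop} {P : ℕ → Prop} {n₀ : ℕ} (h₀ : S n₀)
    (hS : ∀ n, S n → ∃ j, S (n + j + 1) ∧ P ((Finset.range (j + 1)).sup fun k => c (n + k))) :
    P m := by
  have cover : ∀ a, S a → ∀ k, ∃ n j, a ≤ n ∧ n ≤ a + k ∧ a + k ≤ n + j ∧ S (n + j + 1) ∧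
      P ((Finset.range (j + 1)).sup fun k => c (n + k)) := by
    intro a ha k
    induction k with
    | zero =>
      obtain ⟨j, hj, hP⟩ := hS a ha
      exact ⟨a, j, le_rfl, le_rfl, by omega, hj, hP⟩
    | succ k ih =>
      obtain ⟨n, j, h1, h2, h3, h4, h5⟩ := ih
      by_cases hk : a + (k + 1) ≤ n + j
      · exact ⟨n, j, h1, by omega, hk, h4, h5⟩
      · obtain ⟨j', hj', hP'⟩ := hS _ h4
        exact ⟨n + j + 1, j', by omega, by omega, by omega, hj', hP'⟩
  obtain ⟨N, hN⟩ := Filter.eventually_atTop.1 (hm.eventually_le hc)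
  obtain ⟨n₁, j₁, -, -, h3, h4, -⟩ := cover n₀ h₀ N
  obtain ⟨b, hb, hcb⟩ := Filter.frequently_atTop.1 hm.1 (n₁ + j₁ + 1)
  obtain ⟨n, j, g1, g2, g3, -, g5⟩ := cover _ h4 (b - (n₁ + j₁ + 1))
  convert g5
  refine le_antisymm ?_ (Finset.sup_le fun k _ => hN _ (by omega))
  rw [← hcb]
  have := Finset.le_sup (f := fun k => c (n + k)) (Finset.mem_range.2 (by omega : b - n < j + 1))
  simpa [Nat.add_sub_cancel' (by omega : n ≤ b)] using this

/-! ## The loop construction -/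

theorem loopPG_succ {M : ℕ} {A : PreOPG V} (wf : OPGwf M A) (i : V) (q : V → Option ℕ) (v : V) :
    ∃ v', (loopPG A i q).E v v' := by
  by_cases hv : v ∈ A.exits
  · cases hq : q v with
    | none => exact ⟨v, Or.inr (Or.inr ⟨hv, hq, rfl⟩)⟩
    | some m => exact ⟨i, Or.inr (Or.inl ⟨hv, ⟨m, hq⟩, rfl⟩)⟩
  · obtain ⟨v', h⟩ := wf.succ v
    exact ⟨v', Or.inl ⟨h, hv⟩⟩

theorem loopPG_E_of_notMem {A : PreOPG V} {i : V} {q : V → Option ℕ} {v v' : V}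
    (hv : v ∉ A.exits) : (loopPG A i q).E v v' ↔ A.E v v' := by
  simp [loopPG, hv]

theorem loopPG_E_of_some {A : PreOPG V} {i : V} {q : V → Option ℕ} {v v' : V} {m : ℕ}
    (hv : v ∈ A.exits) (hq : q v = some m) : (loopPG A i q).E v v' ↔ v' = i := by
  simp [loopPG, hv, hq]

theorem loopPG_E_of_none {A : PreOPG V} {i : V} {q : V → Option ℕ} {v v' : V}
    (hv : v ∈ A.exits) (hq : q v = none) : (loopPG A i q).E v v' ↔ v' = v := by
  simp [loopPG, hv, hq]

theorem loopPG_Ω_of_notMem {A : PreOPG V} {i : V} {q : V → Option ℕ} {v v' : V}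
    (hv : v ∉ A.exits) : (loopPG A i q).Ω v v' = A.Ω v v' := by
  simp [loopPG, hv]

theorem loopPG_Ω_of_some {A : PreOPG V} {i : V} {q : V → Option ℕ} {v v' : V} {m : ℕ}
    (hv : v ∈ A.exits) (hq : q v = some m) : (loopPG A i q).Ω v v' = m := by
  simp [loopPG, hv, hq]

theorem loopPG_Ω_of_none {A : PreOPG V} {i : V} {q : V → Option ℕ} {v v' : V}
    (hv : v ∈ A.exits) (hq : q v = none) : (loopPG A i q).Ω v v' = 1 := by
  simp [loopPG, hv, hq]

theorem loopPG_Ω_le {M : ℕ} (hM2 : 2 ≤ M) {A : PreOPG V} (wf : OPGwf M A) {i : V}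
    {q : V → Option ℕ} (hq : QueryWF M A q) {v v' : V} (h : (loopPG A i q).E v v') :
    (loopPG A i q).Ω v v' ≤ M := by
  by_cases hv : v ∈ A.exits
  · cases hqv : q v with
    | none => rw [loopPG_Ω_of_none hv hqv]; omega
    | some m => rw [loopPG_Ω_of_some hv hqv]; exact hq v hv m hqv
  · rw [loopPG_Ω_of_notMem hv]
    exact wf.prio_le _ _ ((loopPG_E_of_notMem hv).1 h)

theorem OPGwf.eve_of_mem_exits {M : ℕ} {A : PreOPG V} (wf : OPGwf M A) {v : V}
    (hv : v ∈ A.exits) : A.eve v = true :=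
  wf.ends_eve v (List.mem_append_right _ hv)

/-- A denotation after which answering with the query `q` benefits Player ∃. -/
def Beats (q : V → Option ℕ) : Dom V → Prop
  | .bot => False
  | .top => True
  | .ex o m => ∃ k, q o = some k ∧ Even (max m k)

/-- The maximal priority of a round of the loop ending at an exit. -/
theorem sup_loop_round {A : PreOPG V} {i : V} {q : V → Option ℕ} {p : ℕ → V} {j k : ℕ}
    (hlt : ∀ l < j, p l ∉ A.exits) (hj : p j ∈ A.exits) (hk : q (p j) = some k) :
    ((Finset.range (j + 1)).sup fun l => (loopPG A i q).Ω (p l) (p (l + 1))) =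
      max ((Finset.range j).sup fun l => A.Ω (p l) (p (l + 1))) k := by
  rw [Finset.range_add_one, Finset.sup_insert, loopPG_Ω_of_some hj hk, max_comm]
  congr 1
  exact Finset.sup_congr rfl fun l hl => loopPG_Ω_of_notMem (hlt l (Finset.mem_range.1 hl))

/-- The part of a history after its last visit to an exit. -/
noncomputable def lastRound (A : PreOPG V) (h : List V) : List V :=
  h.foldl (fun acc v => if v ∈ A.exits then [] else acc ++ [v]) []

theorem lastRound_append (A : PreOPG V) (h : List V) (v : V) :
    lastRound A (h ++ [v]) = if v ∈ A.exits then [] else lastRound A h ++ [v] := by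
  simp [lastRound]

/-- Play `σ` afresh in every round of the loop. -/
noncomputable def loopStrat (A : PreOPG V) (i : V) (q : V → Option ℕ) (σ : List V → V → V)
    (h : List V) (v : V) : V :=
  if v ∈ A.exits then (if q v = none then v else i) else σ (lastRound A h) v

theorem isEStrat_loopStrat {A : PreOPG V} {i : V} {q : V → Option ℕ} {σ : List V → V → V}
    (hσ : IsEStrat A.toPreGame σ) : IsEStrat (loopPG A i q) (loopStrat A i q σ) := by
  intro h v hv
  by_cases hx : v ∈ A.exits
  · cases hq : q v with
    | none => simp [loopStrat, hx, hq, loopPG_E_of_none hx hq]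
    | some m => simp [loopStrat, hx, hq, loopPG_E_of_some hx hq]
  · simpa [loopStrat, hx, loopPG_E_of_notMem hx] using hσ _ v hv

theorem winningNode_loop_of_beats {M : ℕ} (hM2 : 2 ≤ M) {A : PreOPG V} (wf : OPGwf M A) {i : V}
    {q : V → Option ℕ} (hq : QueryWF M A q) {σ : List V → V → V}
    (hσ : IsEStrat A.toPreGame σ) (hb : ∀ d ∈ denSet A σ i, Beats q d) :
    WinningNode (loopPG A i q) i := by
  refine (winningNode_iff (loopPG_succ wf i q) i).2
    ⟨_, isEStrat_loopStrat hσ, fun p hp => ?_⟩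
  have hb' : ∀ w d, Consistent A.toPreGame σ i w → PlayDen A w d → Beats q d :=
    fun w d hw hd => hb d ((mem_denSet_iff wf.succ σ i d).2 ⟨w, hw, hd⟩)
  have hbound : ∀ j, (loopPG A i q).Ω (p j) (p (j + 1)) ≤ M :=
    fun j => loopPG_Ω_le hM2 wf hq (hp.edge (isEStrat_loopStrat hσ) j)
  let S : ℕ → Prop := fun n => p n = i ∧ lastRound A ((List.range n).map p) = []
  have hist : ∀ n, S n → ∀ k, (∀ l < k, p (n + l) ∉ A.exits) →
      lastRound A ((List.range (n + k)).map p) = (List.range k).map fun l => p (n + l) := by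
    intro n hn k
    induction k with
    | zero => intro _; simpa using hn.2
    | succ k ih =>
      intro hl
      rw [← add_assoc, List.range_succ, List.map_append, List.map_singleton, lastRound_append,
        if_neg (hl k (by omega)), ih fun l hlk => hl l (by omega), List.range_succ]
      simp
  have step : ∀ n, S n → ∀ k, (∀ l < k + 1, p (n + l) ∉ A.exits) →
      (A.eve (p (n + k)) = true →
        p (n + (k + 1)) = σ ((List.range k).map fun l => p (n + l)) (p (n + k))) ∧
      (A.eve (p (n + k)) = false → A.E (p (n + k)) (p (n + (k + 1)))) := by
    intro n hn k hl
    have hk := hl k (by omega)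
    refine ⟨fun h => ?_, fun h => ?_⟩
    · rw [← hist n hn k fun l hlk => hl l (by omega), ← add_assoc, (hp.2 (n + k)).1 h]
      simp [loopStrat, hk]
    · exact (loopPG_E_of_notMem hk).1 ((hp.2 (n + k)).2 h)
  have hS₀ : S 0 := ⟨hp.1, by simp [lastRound]⟩
  by_cases hstay : ∃ n, S n ∧ ∀ l, p (n + l) ∉ A.exits
  · obtain ⟨n, hn, hl⟩ := hstay
    have hw : Consistent A.toPreGame σ i fun l => p (n + l) :=
      ⟨hn.1, fun k => step n hn k fun l _ => hl l⟩
    have hwin : PlayWins A.toPreGame fun l => p (n + l) := by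
      by_contra hlose
      exact hb' _ _ hw (Or.inr (Or.inr ⟨hl, hlose, rfl⟩))
    obtain ⟨m, hm, hlim⟩ := hwin
    refine ⟨m, hm, (isLimMax_shift (c := fun j => (loopPG A i q).Ω (p j) (p (j + 1))) n).1 ?_⟩
    simp only [loopPG_Ω_of_notMem (hl _)]
    exact hlim
  · push Not at hstay
    obtain ⟨m, hlim⟩ := exists_isLimMax hbound
    refine ⟨m, hlim.of_rounds hbound (P := Even) hS₀ fun n hn => ?_, hlim⟩
    let j := Nat.find (hstay n hn)
    have hj : p (n + j) ∈ A.exits := Nat.find_spec (hstay n hn)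
    have hlt : ∀ l < j, p (n + l) ∉ A.exits := fun l hl => Nat.find_min (hstay n hn) hl
    have hw : Consistent A.toPreGame σ i fun l => p (n + min l j) := by
      refine ⟨by simpa using hn.1, fun k => ?_⟩
      rcases lt_or_ge k j with hk | hk
      · have := step n hn k fun l hl => hlt l (by omega)
        have hmap : ((List.range k).map fun l => p (n + min l j)) =
            (List.range k).map fun l => p (n + l) :=
          List.map_congr_left fun l hl => by
            rw [min_eq_left (by have := List.mem_range.1 hl; omega)]
        simpa only [hmap, min_eq_left hk.le, min_eq_left (Nat.succ_le_of_lt hk)] using this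
      · simp only [min_eq_right hk, min_eq_right (hk.trans (Nat.le_succ k))]
        have he := wf.eve_of_mem_exits hj
        exact ⟨fun h => (wf.exit_sink _ hj _ (hσ _ _ h)).symm, fun h => by simp [he] at h⟩
    have hbeat := hb' _ _ hw (Or.inl ⟨j, by simpa using hj, fun k hk => by
      simpa [min_eq_left hk.le] using hlt k hk, rfl⟩)
    obtain ⟨k, hk, heven⟩ := hbeat
    simp only [min_self] at hk
    refine ⟨j, ⟨?_, ?_⟩, ?_⟩
    · exact (loopPG_E_of_some hj hk).1 (hp.edge (isEStrat_loopStrat hσ) (n + j))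
    · rw [List.range_succ, List.map_append, List.map_singleton, lastRound_append, if_pos hj]
    · have := sup_loop_round (i := i) (p := fun l => p (n + l)) hlt hj hk
      simp only [← add_assoc] at this ⊢
      rw [this]
      convert heven using 2
      refine Finset.sup_congr rfl fun l hl => ?_
      have := Finset.mem_range.1 hl
      simp only [min_eq_left this.le, min_eq_left (Nat.succ_le_of_lt this), add_assoc]

/-- A strategy of the loop, restricted to the round that follows the history `H`. -/
noncomputable def roundStrat (A : PreOPG V) (τ : List V → V → V) (H h : List V) (v : V) : V :=
  if v ∈ A.exits then v else τ (H ++ h) v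

theorem isEStrat_roundStrat {M : ℕ} {A : PreOPG V} (wf : OPGwf M A) {i : V} {q : V → Option ℕ}
    {τ : List V → V → V} (hτ : IsEStrat (loopPG A i q) τ) (H : List V) :
    IsEStrat A.toPreGame (roundStrat A τ H) := by
  intro h v hv
  by_cases hx : v ∈ A.exits
  · simpa [roundStrat, hx] using (wf.exit_self v hx).1
  · simpa [roundStrat, hx, loopPG_E_of_notMem hx] using hτ (H ++ h) v hv

/-- Concatenation of the rounds `P H`: the pair of the history before the current round and the
position in the current round, after `n` steps. -/
noncomputable def roundState (A : PreOPG V) (q : V → Option ℕ) (P : List V → ℕ → V) :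
    ℕ → List V × ℕ
  | 0 => ([], 0)
  | n + 1 =>
      let s := roundState A q P n
      if P s.1 s.2 ∈ A.exits ∧ q (P s.1 s.2) ≠ none then
        (s.1 ++ (List.range (s.2 + 1)).map (P s.1), 0)
      else (s.1, s.2 + 1)

/-- The play obtained by concatenating the rounds `P H`. -/
noncomputable def roundPlay (A : PreOPG V) (q : V → Option ℕ) (P : List V → ℕ → V) (n : ℕ) : V :=
  P (roundState A q P n).1 (roundState A q P n).2

theorem map_roundPlay (A : PreOPG V) (q : V → Option ℕ) (P : List V → ℕ → V) (n : ℕ) :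
    (List.range n).map (roundPlay A q P) =
      (roundState A q P n).1 ++
        (List.range (roundState A q P n).2).map (P (roundState A q P n).1) := by
  induction n with
  | zero => simp [roundState]
  | succ n ih =>
    rw [List.range_succ, List.map_append, ih, roundState]
    split_ifs <;> simp [List.range_succ, roundPlay]

theorem roundState_add {A : PreOPG V} {q : V → Option ℕ} {P : List V → ℕ → V} {n : ℕ}
    {H : List V} (hn : roundState A q P n = (H, 0)) (k : ℕ)
    (hk : ∀ l < k, ¬ (P H l ∈ A.exits ∧ q (P H l) ≠ none)) :
    roundState A q P (n + k) = (H, k) := by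
  induction k with
  | zero => exact hn
  | succ k ih =>
    rw [← add_assoc, roundState, ih fun l hl => hk l (by omega)]
    exact if_neg (hk k (by omega))

theorem consistent_roundPlay {M : ℕ} {A : PreOPG V} (wf : OPGwf M A) {i : V}
    {q : V → Option ℕ} {τ : List V → V → V} (hτ : IsEStrat (loopPG A i q) τ)
    {P : List V → ℕ → V} (hP : ∀ H, Consistent A.toPreGame (roundStrat A τ H) i (P H)) :
    Consistent (loopPG A i q) τ i (roundPlay A q P) := by
  refine ⟨(hP []).1, fun n => ?_⟩
  rw [map_roundPlay]
  unfold roundPlay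
  rw [roundState]
  generalize roundState A q P n = s
  obtain ⟨H, k⟩ := s
  by_cases hx : P H k ∈ A.exits
  · have he : A.eve (P H k) = true := wf.eve_of_mem_exits hx
    have hE := hτ (H ++ (List.range k).map (P H)) (P H k) he
    refine ⟨fun _ => ?_, fun h => absurd (he.symm.trans h) (by simp)⟩
    cases hq : q (P H k) with
    | none =>
      rw [loopPG_E_of_none hx hq] at hE
      simp only [hx, ne_eq, not_true_eq_false, and_false, if_false]
      rw [hE, ((hP H).2 k).1 he, roundStrat, if_pos hx]
    | some m =>
      rw [loopPG_E_of_some hx hq] at hE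
      simp only [hx, ne_eq, reduceCtorEq, not_false_eq_true, and_true, if_true]
      rw [hE, (hP _).1]
  · simp only [hx, false_and, if_false]
    refine ⟨fun h => ?_, fun h => (loopPG_E_of_notMem hx).2 (((hP H).2 k).2 h)⟩
    rw [((hP H).2 k).1 h, roundStrat, if_neg hx]

theorem exists_beats_of_winningNode_loop {M : ℕ} (hM2 : 2 ≤ M) {A : PreOPG V} (wf : OPGwf M A)
    {i : V} {q : V → Option ℕ} (hq : QueryWF M A q) (hwin : WinningNode (loopPG A i q) i) :
    ∃ σ, IsEStrat A.toPreGame σ ∧ ∀ d ∈ denSet A σ i, Beats q d := by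
  by_contra! hno
  obtain ⟨τ, hτ, hw⟩ := (winningNode_iff (loopPG_succ wf i q) i).1 hwin
  have hround : ∀ H, ∃ p, Consistent A.toPreGame (roundStrat A τ H) i p ∧
      ∃ d, PlayDen A p d ∧ ¬ Beats q d := by
    intro H
    obtain ⟨d, hd, hnd⟩ := hno _ (isEStrat_roundStrat wf hτ H)
    obtain ⟨p, hp, hpd⟩ := (mem_denSet_iff wf.succ _ i d).1 hd
    exact ⟨p, hp, d, hpd, hnd⟩
  choose P hP hbad using hround
  have hcons := consistent_roundPlay wf hτ hP
  have hbound : ∀ j, (loopPG A i q).Ω (roundPlay A q P j) (roundPlay A q P (j + 1)) ≤ M :=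
    fun j => loopPG_Ω_le hM2 wf hq (hcons.edge hτ j)
  obtain ⟨m, hm, hlim⟩ := (playWins_iff _ _).1 (hw _ hcons)
  refine (Nat.not_even_iff_odd.2 ?_) hm
  refine hlim.of_rounds hbound (P := Odd) (S := fun n => (roundState A q P n).2 = 0)
    (n₀ := 0) rfl fun n hn => ?_
  obtain ⟨H, hH⟩ : ∃ H, roundState A q P n = (H, 0) := ⟨_, Prod.ext rfl hn⟩
  obtain ⟨d, hd, hnd⟩ := hbad H
  rcases hd with ⟨j, hj, hlt, rfl⟩ | ⟨-, -, rfl⟩ | ⟨hl, hlose, rfl⟩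
  · have hplay : ∀ k ≤ j, roundPlay A q P (n + k) = P H k := fun k hk => by
      rw [roundPlay, roundState_add hH k fun l hl h => hlt l (by omega) h.1]
    cases hqj : q (P H j) with
    | none =>
      exfalso
      have hstay : ∀ k, P H (j + k) = P H j := by
        intro k
        induction k with
        | zero => rfl
        | succ k ih =>
          rw [← add_assoc, ((hP H).2 (j + k)).1 (by rw [ih]; exact wf.eve_of_mem_exits hj),
            roundStrat, if_pos (by rw [ih]; exact hj), ih]
      have hno' : ∀ l, ¬ (P H l ∈ A.exits ∧ q (P H l) ≠ none) := by
        intro l h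
        rcases lt_or_ge l j with hl | hl
        · exact hlt l hl h.1
        · have := hstay (l - j)
          rw [Nat.add_sub_cancel' hl] at this
          exact h.2 (this ▸ hqj)
      have hplay' : ∀ k, roundPlay A q P (n + j + k) = P H j := fun k => by
        rw [add_assoc, roundPlay, roundState_add hH (j + k) fun l _ => hno' l]
        exact hstay k
      rw [← isLimMax_shift (n + j)] at hlim
      have hconst : (fun k => (loopPG A i q).Ω (roundPlay A q P (n + j + k))
          (roundPlay A q P (n + j + k + 1))) = fun _ => 1 := by
        funext k
        rw [hplay' k, loopPG_Ω_of_none hj hqj]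
      rw [hconst, isLimMax_const] at hlim
      subst hlim
      exact absurd hm (by decide)
    | some k =>
      have hnext : roundState A q P (n + j + 1) =
          (H ++ (List.range (j + 1)).map (P H), 0) := by
        rw [roundState, roundState_add hH j fun l hl h => hlt l hl h.1]
        exact if_pos ⟨hj, by simp [hqj]⟩
      refine ⟨j, by rw [hnext], ?_⟩
      have hPj : roundPlay A q P (n + j) = P H j := hplay j le_rfl
      have := sup_loop_round (i := i) (p := fun l => roundPlay A q P (n + l))
        (fun l hl => by rw [hplay l hl.le]; exact hlt l hl) (by rw [hPj]; exact hj)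
        (by rw [hPj]; exact hqj)
      simp only [← add_assoc] at this
      rw [this]
      refine Nat.not_even_iff_odd.1 fun h => hnd ⟨k, hqj, ?_⟩
      convert h using 2
      refine Finset.sup_congr rfl fun l hl => ?_
      have hl' := Finset.mem_range.1 hl
      rw [hplay l hl'.le, add_assoc, hplay (l + 1) hl']
  · exact absurd trivial hnd
  · exfalso
    have hplay : ∀ k, roundPlay A q P (n + k) = P H k := fun k => by
      rw [roundPlay, roundState_add hH k fun l _ h => hl l h.1]
    refine hlose ((playWins_iff _ _).2 ⟨m, hm, ?_⟩)
    rw [← isLimMax_shift n] at hlim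
    simpa only [add_assoc, hplay, loopPG_Ω_of_notMem (hl _)] using hlim

/-! ## The orders -/

theorem SubPrio.refl (m : ℕ) : SubPrio m m := by
  rcases Nat.even_or_odd m with h | h <;> simp [SubPrio, h]

theorem SubPrio.trans {a b c : ℕ} (h₁ : SubPrio a b) (h₂ : SubPrio b c) : SubPrio a c := by
  simp only [SubPrio, Nat.odd_iff, Nat.even_iff] at *
  omega

theorem SubPrio.antisymm {a b : ℕ} (h₁ : SubPrio a b) (h₂ : SubPrio b a) : a = b := by
  simp only [SubPrio, Nat.odd_iff, Nat.even_iff] at *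
  omega

theorem SubPrio.total (a b : ℕ) : SubPrio a b ∨ SubPrio b a := by
  simp only [SubPrio, Nat.odd_iff, Nat.even_iff]
  omega

theorem dualP_dualP (m : ℕ) : dualP (dualP m) = m := by
  grind [dualP]

theorem subPrio_dualP_iff (k m : ℕ) : SubPrio (dualP k) m ↔ Even (max m k) := by
  simp only [SubPrio, Nat.odd_iff, Nat.even_iff, dualP]
  split_ifs <;> omega

theorem SubPrio.dual {a b : ℕ} (h : SubPrio a b) : SubPrio (dualP b) (dualP a) := by
  rw [subPrio_dualP_iff, Nat.even_iff]
  simp only [SubPrio, Nat.odd_iff, Nat.even_iff] at h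
  unfold dualP
  split_ifs <;> omega

theorem dualP_le {M m : ℕ} (hM : Even M) (h : m ≤ M) : dualP m ≤ M := by
  rw [Nat.even_iff] at hM
  unfold dualP
  split_ifs <;> omega

theorem domLE_ex_iff {d : Dom V} {o : V} {m : ℕ} :
    DomLE d (Dom.ex o m) ↔ d = Dom.bot ∨ ∃ k, d = Dom.ex o k ∧ SubPrio k m := by
  simp only [DomLE, reduceCtorEq, false_or, Dom.ex.injEq]
  grind

theorem DomLE.refl (d : Dom V) : DomLE d d := by
  cases d with
  | bot => exact Or.inl rfl
  | top => exact Or.inr (Or.inl rfl)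
  | ex o m => exact domLE_ex_iff.2 (Or.inr ⟨m, rfl, SubPrio.refl m⟩)

theorem DomLE.top (d : Dom V) : DomLE d Dom.top := Or.inr (Or.inl rfl)

theorem domLE_bot_iff {d : Dom V} : DomLE d Dom.bot ↔ d = Dom.bot := by
  simp [DomLE]

theorem DomLE.trans {a b c : Dom V} (h₁ : DomLE a b) (h₂ : DomLE b c) : DomLE a c := by
  cases c with
  | bot => rw [domLE_bot_iff.1 h₂] at h₁; exact h₁
  | top => exact DomLE.top a
  | ex o m =>
    obtain rfl | ⟨k, rfl, hk⟩ := domLE_ex_iff.1 h₂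
    · rw [domLE_bot_iff.1 h₁]; exact Or.inl rfl
    · obtain rfl | ⟨l, rfl, hl⟩ := domLE_ex_iff.1 h₁
      · exact Or.inl rfl
      · exact domLE_ex_iff.2 (Or.inr ⟨l, rfl, hl.trans hk⟩)

theorem UpLE.trans {R S T : Set (Dom V)} (h₁ : UpLE R S) (h₂ : UpLE S T) : UpLE R T := by
  intro d hd
  obtain ⟨e, he, hed⟩ := h₂ d hd
  obtain ⟨f, hf, hfe⟩ := h₁ e he
  exact ⟨f, hf, hfe.trans hed⟩

theorem UpLE.refl (T : Set (Dom V)) : UpLE T T := fun d hd => ⟨d, hd, DomLE.refl d⟩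

/-- A numerical rank, monotone along `⪯_D` for priorities bounded by `M`. -/
def Dom.rank (M : ℕ) : Dom V → ℕ
  | .bot => 0
  | .top => 2 * M + 2
  | .ex _ m => if m % 2 = 1 then M - m + 1 else M + m + 1

theorem rank_lt_of_domLE {M : ℕ} {A : PreOPG V} {d d' : Dom V} (hd : InDom M A d)
    (hd' : InDom M A d') (h : DomLE d' d) (hne : d' ≠ d) : d'.rank M < d.rank M := by
  cases d with
  | bot => exact absurd (domLE_bot_iff.1 h) hne
  | top =>
    cases d' with
    | bot => simp [Dom.rank]
    | top => exact absurd rfl hne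
    | ex o m =>
      have := (hd' o m rfl).2
      simp only [Dom.rank]
      split_ifs <;> omega
  | ex o m =>
    have hm := (hd o m rfl).2
    obtain rfl | ⟨k, rfl, hk⟩ := domLE_ex_iff.1 h
    · simp only [Dom.rank]
      split_ifs <;> omega
    · have hkM := (hd' o k rfl).2
      have hkm : k ≠ m := fun h => hne (by rw [h])
      simp only [SubPrio, Nat.odd_iff, Nat.even_iff] at hk
      simp only [Dom.rank]
      split_ifs <;> omega

theorem upLE_minSet {M : ℕ} {A : PreOPG V} {T : Set (Dom V)} (hT : ∀ d ∈ T, InDom M A d) :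
    UpLE (minSet T) T := by
  intro d
  induction hr : d.rank M using Nat.strong_induction_on generalizing d with
  | _ n ih =>
    intro hd
    by_cases hmin : d ∈ minSet T
    · exact ⟨d, hmin, DomLE.refl d⟩
    · have : ∃ d' ∈ T, DomLE d' d ∧ d' ≠ d := by
        by_contra! hcon
        exact hmin ⟨hd, hcon⟩
      obtain ⟨d', hd', hle, hne⟩ := this
      obtain ⟨e, he, hed⟩ :=
        ih _ (hr ▸ rank_lt_of_domLE (hT d hd) (hT d' hd') hle hne) d' rfl hd'
      exact ⟨e, he, hed.trans hle⟩

theorem upLE_minSet_iff {M : ℕ} {A : PreOPG V} {R T : Set (Dom V)}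
    (hT : ∀ d ∈ T, InDom M A d) : UpLE R (minSet T) ↔ UpLE R T :=
  ⟨fun h => h.trans (upLE_minSet hT), fun h d hd => h d hd.1⟩

/-! ## Denotations and duals of queries -/

theorem denSet_inDom {M : ℕ} {A : PreOPG V} (wf : OPGwf M A) {σ : List V → V → V} {i : V}
    (hσ : IsEStrat A.toPreGame σ) : ∀ d ∈ denSet A σ i, InDom M A d := by
  rintro d hd o m rfl
  obtain ⟨p, hp, hd⟩ := (mem_denSet_iff wf.succ σ i _).1 hd
  rcases hd with ⟨j, hj, -, he⟩ | ⟨-, -, he⟩ | ⟨-, -, he⟩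
  · obtain ⟨rfl, rfl⟩ := Dom.ex.inj he
    exact ⟨hj, Finset.sup_le fun k _ => wf.prio_le _ _ (hp.edge hσ k)⟩
  · cases he
  · cases he

theorem denSet_nonempty {M : ℕ} {A : PreOPG V} (wf : OPGwf M A) (σ : List V → V → V) (i : V) :
    (denSet A σ i).Nonempty := by
  choose s hs using wf.succ
  obtain ⟨d, hd⟩ := exists_playDen A (playSeq A.toPreGame σ (fun _ v => s v) i)
  exact ⟨d, _, fun _ v _ => hs v, hd⟩

theorem queryDual_nonempty (A : PreOPG V) (q : V → Option ℕ) : (queryDual A q).Nonempty := by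
  by_cases h : ∀ o ∈ A.exits, q o = none
  · exact ⟨_, Or.inl ⟨h, rfl⟩⟩
  · push Not at h
    obtain ⟨o, ho, hq⟩ := h
    obtain ⟨m, hm⟩ := Option.ne_none_iff_exists'.1 hq
    exact ⟨_, Or.inr ⟨o, ho, m, hm, rfl⟩⟩

theorem bot_notMem_queryDual (A : PreOPG V) (q : V → Option ℕ) :
    Dom.bot ∉ queryDual A q := by
  simp [queryDual]

theorem ex_mem_queryDual_iff {A : PreOPG V} {q : V → Option ℕ} {o : V} {m : ℕ} :
    Dom.ex o m ∈ queryDual A q ↔ o ∈ A.exits ∧ ∃ k, q o = some k ∧ m = dualP k := by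
  constructor
  · rintro (⟨-, h⟩ | ⟨o', ho, k, hk, h⟩)
    · cases h
    · obtain ⟨rfl, rfl⟩ := Dom.ex.inj h
      exact ⟨ho, k, hk, rfl⟩
  · rintro ⟨ho, k, hk, rfl⟩
    exact Or.inr ⟨o, ho, k, hk, rfl⟩

theorem exists_queryDual_domLE_ex_iff {A : PreOPG V} {q : V → Option ℕ} {o : V} {m : ℕ} :
    (∃ d ∈ queryDual A q, DomLE d (Dom.ex o m)) ↔
      o ∈ A.exits ∧ ∃ k, q o = some k ∧ SubPrio (dualP k) m := by
  constructor
  · rintro ⟨d, hd, hle⟩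
    obtain rfl | ⟨k, rfl, hk⟩ := domLE_ex_iff.1 hle
    · exact absurd hd (bot_notMem_queryDual A q)
    · obtain ⟨ho, k, hq, rfl⟩ := ex_mem_queryDual_iff.1 hd
      exact ⟨ho, k, hq, hk⟩
  · rintro ⟨ho, k, hq, hk⟩
    exact ⟨_, ex_mem_queryDual_iff.2 ⟨ho, k, hq, rfl⟩, domLE_ex_iff.2 (Or.inr ⟨_, rfl, hk⟩)⟩

theorem upLE_queryDual_iff {M : ℕ} {A : PreOPG V} {T : Set (Dom V)}
    (hT : ∀ d ∈ T, InDom M A d) (q : V → Option ℕ) :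
    UpLE (queryDual A q) T ↔ ∀ d ∈ T, Beats q d := by
  refine forall₂_congr fun d hd => ?_
  cases d with
  | bot => simp [Beats, domLE_bot_iff, bot_notMem_queryDual]
  | top =>
    obtain ⟨e, he⟩ := queryDual_nonempty A q
    exact iff_of_true ⟨e, he, DomLE.top e⟩ trivial
  | ex o m =>
    rw [exists_queryDual_domLE_ex_iff]
    simp [Beats, subPrio_dualP_iff, (hT _ hd o m rfl).1]

theorem winningNode_loop_iff {M : ℕ} (hM2 : 2 ≤ M) {A : PreOPG V} (wf : OPGwf M A) {i : V}
    {q : V → Option ℕ} (hq : QueryWF M A q) :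
    WinningNode (loopPG A i q) i ↔
      ∃ σ, IsEStrat A.toPreGame σ ∧ UpLE (queryDual A q) (minSet (denSet A σ i)) := by
  constructor
  · intro h
    obtain ⟨σ, hσ, hb⟩ := exists_beats_of_winningNode_loop hM2 wf hq h
    have hD := denSet_inDom (i := i) wf hσ
    exact ⟨σ, hσ, (upLE_minSet_iff hD).2 ((upLE_queryDual_iff hD q).2 hb)⟩
  · rintro ⟨σ, hσ, hU⟩
    have hD := denSet_inDom (i := i) wf hσ
    exact winningNode_loop_of_beats hM2 wf hq hσ
      ((upLE_queryDual_iff hD q).1 ((upLE_minSet_iff hD).1 hU))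

theorem queryDual_congr {A : PreOPG V} {q q' : V → Option ℕ} (h : QueryEq A q q') :
    queryDual A q = queryDual A q' := by
  ext d
  simp only [queryDual, Set.mem_ofPred_eq]
  refine or_congr (and_congr_left fun _ => forall₂_congr fun o ho => by rw [h o ho]) ?_
  exact exists_congr fun o => and_congr_right fun ho => by rw [h o ho]

theorem upLE_queryDual_of_queryLE {A : PreOPG V} {q q' : V → Option ℕ} (h : QueryLE A q' q) :
    UpLE (queryDual A q) (queryDual A q') := by
  intro d hd
  cases d with
  | bot => exact absurd hd (bot_notMem_queryDual A q')
  | top =>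
    obtain ⟨e, he⟩ := queryDual_nonempty A q
    exact ⟨e, he, DomLE.top e⟩
  | ex o m =>
    obtain ⟨ho, k, hk, rfl⟩ := ex_mem_queryDual_iff.1 hd
    refine exists_queryDual_domLE_ex_iff.2 ⟨ho, ?_⟩
    rcases h o ho with h | ⟨a, b, ha, hb, hab⟩
    · simp [hk] at h
    · obtain rfl : k = a := Option.some.inj (hk.symm.trans ha)
      exact ⟨b, hb, hab.dual⟩

theorem queryEq_of_upLE {A : PreOPG V} {q q' : V → Option ℕ} (h : QueryLE A q' q)
    (hU : UpLE (queryDual A q') (queryDual A q)) : QueryEq A q' q := by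
  intro o ho
  cases hq : q o with
  | none =>
    rcases h o ho with h | ⟨a, b, -, hb, -⟩
    · exact h
    · simp [hq] at hb
  | some m =>
    obtain ⟨-, k, hk, hkm⟩ := exists_queryDual_domLE_ex_iff.1
      (hU _ (ex_mem_queryDual_iff.2 ⟨ho, m, hq, rfl⟩))
    rcases h o ho with h | ⟨a, b, ha, hb, hab⟩
    · simp [hk] at h
    · obtain rfl : k = a := Option.some.inj (hk.symm.trans ha)
      obtain rfl : m = b := Option.some.inj (hq.symm.trans hb)
      have := hkm.dual
      rw [dualP_dualP, dualP_dualP] at this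
      rw [hk, hab.antisymm this]

theorem exists_queryDual_eq_minSet {M : ℕ} (hM : Even M) {A : PreOPG V} {T : Set (Dom V)}
    (hT : ∀ d ∈ T, InDom M A d) (hne : T.Nonempty) (hbot : Dom.bot ∉ T) :
    ∃ q, QueryWF M A q ∧ queryDual A q = minSet T := by
  have huniq : ∀ o a b, Dom.ex o a ∈ minSet T → Dom.ex o b ∈ minSet T → a = b := by
    intro o a b ha hb
    rcases SubPrio.total a b with h | h
    · exact (Dom.ex.inj (hb.2 _ ha.1 (domLE_ex_iff.2 (Or.inr ⟨a, rfl, h⟩)))).2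
    · exact (Dom.ex.inj (ha.2 _ hb.1 (domLE_ex_iff.2 (Or.inr ⟨b, rfl, h⟩)))).2.symm
  let q : V → Option ℕ := fun o =>
    if h : ∃ m, Dom.ex o m ∈ minSet T then some (dualP h.choose) else none
  have hq : ∀ o m, Dom.ex o m ∈ minSet T → q o = some (dualP m) := fun o m h => by
    have hex : ∃ m, Dom.ex o m ∈ minSet T := ⟨m, h⟩
    simp only [q, dif_pos hex, huniq o _ _ hex.choose_spec h]
  have hq' : ∀ o k, q o = some k → Dom.ex o (dualP k) ∈ minSet T := fun o k h => by
    by_cases hex : ∃ m, Dom.ex o m ∈ minSet T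
    · simp only [q, dif_pos hex, Option.some.injEq] at h
      rw [← h, dualP_dualP]
      exact hex.choose_spec
    · simp [q, hex] at h
  refine ⟨q, fun o _ k hk => ?_, Set.ext fun d => ?_⟩
  · simpa [dualP_dualP] using dualP_le hM (hT _ (hq' o k hk).1 _ _ rfl).2
  · cases d with
    | bot => exact iff_of_false (bot_notMem_queryDual A q) fun h => hbot h.1
    | ex o m =>
      rw [ex_mem_queryDual_iff]
      constructor
      · rintro ⟨-, k, hk, rfl⟩
        exact hq' o k hk
      · intro h
        exact ⟨(hT _ h.1 o m rfl).1, _, hq o m h, (dualP_dualP m).symm⟩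
    | top =>
      have : Dom.top ∈ queryDual A q ↔ ∀ o ∈ A.exits, q o = none := by simp [queryDual]
      rw [this]
      constructor
      · intro hnone
        obtain ⟨d, hd⟩ := hne
        obtain ⟨e, he, -⟩ := upLE_minSet hT d hd
        cases e with
        | bot => exact absurd he.1 hbot
        | top => exact he
        | ex o m =>
          have := hnone o (hT _ he.1 o m rfl).1
          simp [hq o m he] at this
      · intro htop o _
        by_contra hqo
        obtain ⟨k, hk⟩ := Option.ne_none_iff_exists'.1 hqo
        exact absurd (htop.2 _ (hq' o k hk).1 (DomLE.top _)) (by simp)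

theorem queryLE_of_upLE {A : PreOPG V} {q q' : V → Option ℕ}
    (h : UpLE (queryDual A q) (queryDual A q')) : QueryLE A q' q := by
  intro o ho
  cases hk : q' o with
  | none => exact Or.inl rfl
  | some k =>
    obtain ⟨-, l, hl, hle⟩ := exists_queryDual_domLE_ex_iff.1
      (h _ (ex_mem_queryDual_iff.2 ⟨ho, k, hk, rfl⟩))
    have := hle.dual
    rw [dualP_dualP, dualP_dualP] at this
    exact Or.inr ⟨k, l, rfl, hl, this⟩

/-- `q` is minimal among queries making `i` winning in the loop
construction iff its dual `A(q)` is Pareto-optimal. -/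
theorem minimal_query_iff_pareto {V : Type} (M : ℕ) (hM : Even M) (hM2 : 2 ≤ M)
    (A : PreOPG V) (wf : OPGwf M A) (i : V) (hi : i ∈ A.ent)
    (q : V → Option ℕ) (hq : QueryWF M A q) :
    (WinningNode (loopPG A i q) i ∧
      ∀ q', QueryWF M A q' → QueryLE A q' q → ¬ QueryEq A q' q →
        ¬ WinningNode (loopPG A i q') i) ↔
    queryDual A q ∈ pareto A i := by
  constructor
  · rintro ⟨hwin, hmin⟩
    have key : ∀ σ, IsEStrat A.toPreGame σ →
        UpLE (queryDual A q) (minSet (denSet A σ i)) →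
        queryDual A q = minSet (denSet A σ i) := by
      intro σ hσ hU
      have hD := denSet_inDom (i := i) wf hσ
      have hbot : Dom.bot ∉ denSet A σ i := fun h =>
        (upLE_queryDual_iff hD q).1 ((upLE_minSet_iff hD).1 hU) _ h
      obtain ⟨q', hq', heq⟩ := exists_queryDual_eq_minSet hM hD (denSet_nonempty wf σ i) hbot
      by_contra hne
      refine hmin q' hq' (queryLE_of_upLE (heq ▸ hU))
        (fun h => hne (heq ▸ (queryDual_congr h).symm)) ?_
      exact (winningNode_loop_iff hM2 wf hq').2 ⟨σ, hσ, heq ▸ UpLE.refl _⟩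
    obtain ⟨σ, hσ, hU⟩ := (winningNode_loop_iff hM2 wf hq).1 hwin
    refine ⟨⟨σ, hσ, key σ hσ hU⟩, ?_⟩
    rintro _ ⟨σ', hσ', rfl⟩ hU'
    rw [← key σ' hσ' hU']
    exact UpLE.refl _
  · rintro ⟨⟨σ, hσ, heq⟩, hmax⟩
    refine ⟨(winningNode_loop_iff hM2 wf hq).2 ⟨σ, hσ, heq ▸ UpLE.refl _⟩, ?_⟩
    intro q' hq' hle hne hwin
    obtain ⟨σ', hσ', hU'⟩ := (winningNode_loop_iff hM2 wf hq').1 hwin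
    exact hne (queryEq_of_upLE hle (hU'.trans
      (hmax _ ⟨σ', hσ', rfl⟩ ((upLE_queryDual_of_queryLE hle).trans hU'))))
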